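/- Define d_n = (15^{2n}/(n!)²)·c_{5,2n+1} for integers n ≥ 0. Then for every integer n ≥ 3, n²(n−1)²·d_n = 4(n−1)²(259n²−518n+285)·d_{n−1} − 3600(35n⁴−210n³+483n²−504n+201)·d_{n−2} + 3240000(n−2)⁴·d_{n−3}. -/

import Mathlib

open MeasureTheory

/-- The modified Bessel function `K₀`, via `K₀(x) = ∫₀^∞ exp(−x cosh t) dt`. -/
noncomputable def besselK0 (x : ℝ) : ℝ :=
  ∫ t in Set.Ioi (0 : ℝ), Real.exp (-x * Real.cosh t)

/-- The Bessel moment `c_{m,k} = ∫₀^∞ x^k K₀(x)^m dx`. -/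
noncomputable def besselMoment (m k : ℕ) : ℝ :=
  ∫ x in Set.Ioi (0 : ℝ), x ^ k * besselK0 x ^ m

/-- `∫₀^∞ cosh(t)^i exp(−x cosh t) dt`, which is `(-1)^i` times the `i`-th derivative of `K₀`. -/
noncomputable def coshMoment (i : ℕ) (x : ℝ) : ℝ :=
  ∫ t in Set.Ioi (0 : ℝ), Real.cosh t ^ i * Real.exp (-x * Real.cosh t)

lemma exp_half_le_cosh (t : ℝ) : Real.exp t / 2 ≤ Real.cosh t := by
  rw [Real.cosh_eq]
  linarith [Real.exp_pos (-t)]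

lemma integrableOn_cosh_pow_mul_exp (i : ℕ) {x : ℝ} (hx : 0 < x) :
    IntegrableOn (fun t => Real.cosh t ^ i * Real.exp (-x * Real.cosh t)) (Set.Ioi 0) := by
  have hg : IntegrableOn
      (fun t : ℝ => ((i + 1).factorial / x ^ (i + 1) * 2) * Real.exp (-1 * t)) (Set.Ioi 0) :=
    (exp_neg_integrableOn_Ioi 0 one_pos).const_mul _
  refine Integrable.mono' hg (by fun_prop) (Filter.Eventually.of_forall fun t => ?_)
  have hc : 0 < Real.cosh t := Real.cosh_pos t
  have hpow := Real.pow_div_factorial_le_exp (x * Real.cosh t) (by positivity) (i + 1)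
  have hf : (0 : ℝ) < (i + 1).factorial := by positivity
  have hct := exp_half_le_cosh t
  rw [Real.norm_of_nonneg (by positivity), neg_mul, Real.exp_neg, neg_one_mul, Real.exp_neg]
  rw [div_le_iff₀ hf] at hpow
  have he := Real.exp_pos t
  have hE := Real.exp_pos (x * Real.cosh t)
  rw [← div_eq_mul_inv, ← div_eq_mul_inv, div_le_div_iff₀ hE he, div_mul_eq_mul_div,
    div_mul_eq_mul_div, le_div_iff₀ (by positivity)]
  calc Real.cosh t ^ i * Real.exp t * x ^ (i + 1)
      ≤ Real.cosh t ^ i * (2 * Real.cosh t) * x ^ (i + 1) := by gcongr; linarith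
    _ = 2 * (x * Real.cosh t) ^ (i + 1) := by ring
    _ ≤ 2 * (Real.exp (x * Real.cosh t) * (i + 1).factorial) := by gcongr
    _ = _ := by ring

lemma hasDerivAt_coshMoment (i : ℕ) {x : ℝ} (hx : 0 < x) :
    HasDerivAt (coshMoment i) (-coshMoment (i + 1) x) x := by
  have h := hasDerivAt_integral_of_dominated_loc_of_deriv_le
    (μ := volume.restrict (Set.Ioi (0 : ℝ)))
    (F := fun y t => Real.cosh t ^ i * Real.exp (-y * Real.cosh t))
    (F' := fun y t => -(Real.cosh t ^ (i + 1) * Real.exp (-y * Real.cosh t)))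
    (bound := fun t => Real.cosh t ^ (i + 1) * Real.exp (-(x / 2) * Real.cosh t))
    (Ioi_mem_nhds (half_lt_self hx))
    (Filter.Eventually.of_forall fun y => by fun_prop)
    (integrableOn_cosh_pow_mul_exp i hx) (by fun_prop)
    (Filter.Eventually.of_forall fun t y hy => by
      have hc := Real.cosh_pos t
      have hy' : x / 2 < y := hy
      rw [norm_neg, Real.norm_of_nonneg (by positivity)]
      gcongr)
    (integrableOn_cosh_pow_mul_exp (i + 1) (half_pos hx))
    (Filter.Eventually.of_forall fun t y _ => by
      have h1 : HasDerivAt (fun y : ℝ => -y * Real.cosh t) (-1 * Real.cosh t) y :=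
        (hasDerivAt_id y).neg.mul_const _
      exact (h1.exp.const_mul (Real.cosh t ^ i)).congr_deriv (by ring))
  exact h.2.congr_deriv (integral_neg _)

lemma mul_coshMoment_two {x : ℝ} (hx : 0 < x) :
    x * coshMoment 2 x = coshMoment 1 x + x * coshMoment 0 x := by
  have i0 := integrableOn_cosh_pow_mul_exp 0 hx
  have i1 := integrableOn_cosh_pow_mul_exp 1 hx
  have i2 := integrableOn_cosh_pow_mul_exp 2 hx
  have hd : ∀ t : ℝ, HasDerivAt (fun t => Real.sinh t * Real.exp (-x * Real.cosh t))
      (Real.cosh t ^ 1 * Real.exp (-x * Real.cosh t)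
        + x * (Real.cosh t ^ 0 * Real.exp (-x * Real.cosh t))
        - x * (Real.cosh t ^ 2 * Real.exp (-x * Real.cosh t))) t := fun t => by
    have h1 : HasDerivAt (fun t : ℝ => -x * Real.cosh t) (-x * Real.sinh t) t :=
      (Real.hasDerivAt_cosh t).const_mul _
    refine ((Real.hasDerivAt_sinh t).mul h1.exp).congr_deriv ?_
    rw [Real.cosh_sq]
    ring
  have i01 : IntegrableOn (fun t => Real.cosh t ^ 1 * Real.exp (-x * Real.cosh t)
      + x * (Real.cosh t ^ 0 * Real.exp (-x * Real.cosh t))) (Set.Ioi 0) :=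
    i1.add (i0.const_mul x)
  have hint : IntegrableOn (fun t => Real.cosh t ^ 1 * Real.exp (-x * Real.cosh t)
      + x * (Real.cosh t ^ 0 * Real.exp (-x * Real.cosh t))
      - x * (Real.cosh t ^ 2 * Real.exp (-x * Real.cosh t))) (Set.Ioi 0) :=
    i01.sub (i2.const_mul x)
  have hg : IntegrableOn (fun t => Real.sinh t * Real.exp (-x * Real.cosh t)) (Set.Ioi 0) := by
    refine Integrable.mono i1 (by fun_prop) (Filter.Eventually.of_forall fun t => ?_)
    have hc := Real.cosh_pos t
    rw [norm_mul, norm_mul, pow_one, Real.norm_of_nonneg hc.le]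
    gcongr
    rw [Real.norm_eq_abs, abs_le]
    constructor <;> rw [Real.cosh_eq, Real.sinh_eq] <;>
      linarith [Real.exp_pos t, Real.exp_pos (-t)]
  have key := integral_Ioi_of_hasDerivAt_of_tendsto' (a := 0) (fun t _ => hd t) hint
    (tendsto_zero_of_hasDerivAt_of_integrableOn_Ioi (fun t _ => hd t) hint hg)
  rw [integral_sub i01 (i2.const_mul x), integral_add i1 (i0.const_mul x),
    integral_const_mul, integral_const_mul] at key
  simp only [Real.sinh_zero, zero_mul, sub_zero] at key
  simp only [coshMoment]
  linarith

lemma exists_pow_mul_coshMoment_le {i : ℕ} (hi : i ≤ 1) :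
    ∃ C : ℝ, 0 ≤ C ∧ ∀ x : ℝ, 0 < x →
      x ^ i * coshMoment i x ≤ C * x ^ (-(1 / 4) : ℝ) * Real.exp (-x / 2) := by
  have hexp : IntegrableOn (fun t : ℝ => Real.exp (-(1 / 4) * t)) (Set.Ioi 0) :=
    exp_neg_integrableOn_Ioi 0 (by norm_num)
  refine ⟨8 * (1 / 2 : ℝ) ^ (-(1 / 4) : ℝ) * ∫ t in Set.Ioi (0 : ℝ), Real.exp (-(1 / 4) * t),
    mul_nonneg (by positivity) (integral_nonneg fun t => (Real.exp_pos _).le), fun x hx => ?_⟩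
  have hb : ∀ y : ℝ, 0 < y →
      y ^ i * Real.exp (-y) ≤ 8 * y ^ (-(1 / 4) : ℝ) * Real.exp (-y / 2) := fun y hy => by
    have h1 : y ^ ((i : ℝ) + 1 / 4) ≤ 1 + y ^ 2 := by
      have hi' : (i : ℝ) ≤ 1 := by exact_mod_cast hi
      rcases le_total y 1 with h | h
      · have := Real.rpow_le_one hy.le h (by positivity : (0 : ℝ) ≤ (i : ℝ) + 1 / 4)
        nlinarith
      · have := Real.rpow_le_rpow_of_exponent_le h (by linarith : (i : ℝ) + 1 / 4 ≤ (2 : ℝ))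
        rw [Real.rpow_two] at this
        linarith
    have h2 : 1 + y ^ 2 ≤ 8 * Real.exp (y / 2) := by
      have := Real.quadratic_le_exp_of_nonneg (half_pos hy).le
      nlinarith
    have h3 : y ^ i = y ^ ((i : ℝ) + 1 / 4) * y ^ (-(1 / 4) : ℝ) := by
      rw [← Real.rpow_add hy, add_neg_cancel_right, Real.rpow_natCast]
    calc y ^ i * Real.exp (-y)
        = y ^ ((i : ℝ) + 1 / 4) * (y ^ (-(1 / 4) : ℝ) * Real.exp (-y)) := by rw [h3]; ring
      _ ≤ 8 * Real.exp (y / 2) * (y ^ (-(1 / 4) : ℝ) * Real.exp (-y)) := by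
          gcongr; exact h1.trans h2
      _ = 8 * y ^ (-(1 / 4) : ℝ) * (Real.exp (y / 2) * Real.exp (-y)) := by ring
      _ = _ := by rw [← Real.exp_add]; ring_nf
  rw [coshMoment, ← integral_const_mul, ← integral_const_mul, ← integral_mul_const,
    ← integral_mul_const]
  refine setIntegral_mono_on ((integrableOn_cosh_pow_mul_exp i hx).const_mul _)
    (((hexp.const_mul _).mul_const _).mul_const _) measurableSet_Ioi fun t _ => ?_
  have hc := Real.cosh_pos t
  have hc1 := Real.one_le_cosh t
  calc x ^ i * (Real.cosh t ^ i * Real.exp (-x * Real.cosh t))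
      = (x * Real.cosh t) ^ i * Real.exp (-(x * Real.cosh t)) := by
        rw [mul_pow, neg_mul]; ring
    _ ≤ 8 * (x * Real.cosh t) ^ (-(1 / 4) : ℝ) * Real.exp (-(x * Real.cosh t) / 2) :=
        hb _ (by positivity)
    _ ≤ 8 * (x * (1 / 2 * Real.exp t)) ^ (-(1 / 4) : ℝ) * Real.exp (-x / 2) := by
        have h1 : (x * Real.cosh t) ^ (-(1 / 4) : ℝ)
            ≤ (x * (1 / 2 * Real.exp t)) ^ (-(1 / 4) : ℝ) := by
          refine Real.rpow_le_rpow_of_nonpos (by positivity) ?_ (by norm_num)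
          gcongr
          linarith [exp_half_le_cosh t]
        have h2 : Real.exp (-(x * Real.cosh t) / 2) ≤ Real.exp (-x / 2) := by
          rw [Real.exp_le_exp]
          nlinarith
        gcongr
    _ = _ := by
        rw [Real.mul_rpow hx.le (by positivity), Real.mul_rpow (by norm_num) (by positivity),
          ← Real.exp_mul, mul_comm t]
        ring

lemma besselK0_eq_coshMoment (x : ℝ) : besselK0 x = coshMoment 0 x := by
  simp [besselK0, coshMoment]

/-- The logarithmic derivative operator `x d/dx` applied to `K₀`. -/
noncomputable def besselK0Theta (x : ℝ) : ℝ := -(x * coshMoment 1 x)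

lemma hasDerivAt_besselK0 {x : ℝ} (hx : 0 < x) :
    HasDerivAt besselK0 (besselK0Theta x / x) x := by
  rw [funext besselK0_eq_coshMoment]
  refine (hasDerivAt_coshMoment 0 hx).congr_deriv ?_
  rw [besselK0Theta]
  field_simp

lemma hasDerivAt_besselK0Theta {x : ℝ} (hx : 0 < x) :
    HasDerivAt besselK0Theta (x * besselK0 x) x := by
  refine ((hasDerivAt_id x).mul (hasDerivAt_coshMoment 1 hx)).neg.congr_deriv ?_
  rw [besselK0_eq_coshMoment]
  have := mul_coshMoment_two hx
  simp only [id]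
  norm_num
  linarith

lemma coshMoment_nonneg (i : ℕ) (x : ℝ) : 0 ≤ coshMoment i x :=
  integral_nonneg fun t => by
    have := Real.cosh_pos t
    positivity

lemma exists_abs_besselK0_pow_mul_le (a b : ℕ) (h2 : 2 ≤ a + b) :
    ∃ C : ℝ, 0 ≤ C ∧ ∀ x : ℝ, 0 < x →
      |besselK0 x ^ a * besselK0Theta x ^ b|
        ≤ C * x ^ (-((a + b : ℕ) / 4) : ℝ) * Real.exp (-x) := by
  obtain ⟨C, hC, hCx⟩ := exists_pow_mul_coshMoment_le (i := 0) (by norm_num)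
  obtain ⟨D, hD, hDx⟩ := exists_pow_mul_coshMoment_le (i := 1) le_rfl
  refine ⟨C ^ a * D ^ b, by positivity, fun x hx => ?_⟩
  have hK : |besselK0 x| ≤ C * x ^ (-(1 / 4) : ℝ) * Real.exp (-x / 2) := by
    rw [besselK0_eq_coshMoment, abs_of_nonneg (coshMoment_nonneg 0 x)]
    simpa using hCx x hx
  have hL : |besselK0Theta x| ≤ D * x ^ (-(1 / 4) : ℝ) * Real.exp (-x / 2) := by
    rw [besselK0Theta, abs_neg, abs_of_nonneg (mul_nonneg hx.le (coshMoment_nonneg 1 x))]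
    simpa using hDx x hx
  have he : Real.exp (-x / 2) ^ (a + b) ≤ Real.exp (-x) := by
    rw [← Real.exp_nat_mul, Real.exp_le_exp]
    have : (2 : ℝ) ≤ (a + b : ℕ) := by exact_mod_cast h2
    nlinarith
  calc |besselK0 x ^ a * besselK0Theta x ^ b| = |besselK0 x| ^ a * |besselK0Theta x| ^ b := by
        rw [abs_mul, abs_pow, abs_pow]
    _ ≤ (C * x ^ (-(1 / 4) : ℝ) * Real.exp (-x / 2)) ^ a
          * (D * x ^ (-(1 / 4) : ℝ) * Real.exp (-x / 2)) ^ b := by gcongr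
    _ = C ^ a * D ^ b * (x ^ (-(1 / 4) : ℝ)) ^ (a + b) * Real.exp (-x / 2) ^ (a + b) := by ring
    _ ≤ C ^ a * D ^ b * (x ^ (-(1 / 4) : ℝ)) ^ (a + b) * Real.exp (-x) := by gcongr
    _ = _ := by
        rw [← Real.rpow_natCast (x ^ (-(1 / 4) : ℝ)), ← Real.rpow_mul hx.le]
        ring_nf

lemma exists_abs_pow_mul_besselK0_pow_mul_le (a b p : ℕ) (h2 : 2 ≤ a + b) :
    ∃ C : ℝ, 0 ≤ C ∧ ∀ x : ℝ, 0 < x →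
      |x ^ p * (besselK0 x ^ a * besselK0Theta x ^ b)|
        ≤ C * (x ^ (p - (a + b : ℕ) / 4 : ℝ) * Real.exp (-x)) := by
  obtain ⟨C, hC, h⟩ := exists_abs_besselK0_pow_mul_le a b h2
  refine ⟨C, hC, fun x hx => ?_⟩
  rw [abs_mul, abs_of_nonneg (by positivity : 0 ≤ x ^ p), sub_eq_add_neg, Real.rpow_add hx,
    Real.rpow_natCast]
  calc _ ≤ x ^ p * (C * x ^ (-((a + b : ℕ) / 4) : ℝ) * Real.exp (-x)) := by
        gcongr
        exact h x hx
    _ = _ := by ring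

lemma continuousOn_pow_mul_besselK0_pow_mul (a b p : ℕ) :
    ContinuousOn (fun x => x ^ p * (besselK0 x ^ a * besselK0Theta x ^ b)) (Set.Ioi 0) := by
  have hK : ContinuousOn besselK0 (Set.Ioi 0) := fun x hx =>
    (hasDerivAt_besselK0 hx).continuousAt.continuousWithinAt
  have hL : ContinuousOn besselK0Theta (Set.Ioi 0) := fun x hx =>
    (hasDerivAt_besselK0Theta hx).continuousAt.continuousWithinAt
  fun_prop

lemma integrableOn_pow_mul_besselK0_pow_mul {a b p : ℕ} (h2 : 2 ≤ a + b) (h7 : a + b ≤ 7)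
    (hp : 1 ≤ p) :
    IntegrableOn (fun x => x ^ p * (besselK0 x ^ a * besselK0Theta x ^ b)) (Set.Ioi 0) := by
  obtain ⟨C, -, h⟩ := exists_abs_pow_mul_besselK0_pow_mul_le a b p h2
  have hp' : (1 : ℝ) ≤ p := by exact_mod_cast hp
  have h7' : ((a + b : ℕ) : ℝ) ≤ 7 := by exact_mod_cast h7
  have hg : IntegrableOn (fun x : ℝ => C * (x ^ (p - (a + b : ℕ) / 4 : ℝ) * Real.exp (-x)))
      (Set.Ioi 0) := by
    have := integrableOn_rpow_mul_exp_neg_mul_rpow (p := 1) (s := p - (a + b : ℕ) / 4) (b := 1)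
      (by linarith) one_pos one_pos
    simpa [IntegrableOn] using this.const_mul C
  refine Integrable.mono' hg
    ((continuousOn_pow_mul_besselK0_pow_mul a b p).aestronglyMeasurable measurableSet_Ioi) ?_
  filter_upwards [ae_restrict_mem measurableSet_Ioi] with x hx
  exact h x hx

lemma continuousWithinAt_pow_mul_besselK0_pow_mul {a b p : ℕ} (h2 : 2 ≤ a + b) (h7 : a + b ≤ 7)
    (hp : 2 ≤ p) :
    ContinuousWithinAt (fun x => x ^ p * (besselK0 x ^ a * besselK0Theta x ^ b))
      (Set.Ici 0) 0 := by
  obtain ⟨C, hC, h⟩ := exists_abs_pow_mul_besselK0_pow_mul_le a b p h2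
  have hp' : (2 : ℝ) ≤ p := by exact_mod_cast hp
  have h7' : ((a + b : ℕ) : ℝ) ≤ 7 := by exact_mod_cast h7
  have hs : (0 : ℝ) < p - (a + b : ℕ) / 4 := by linarith
  have hg : Filter.Tendsto (fun x : ℝ => C * (x ^ (p - (a + b : ℕ) / 4 : ℝ) * Real.exp (-x)))
      (nhdsWithin 0 (Set.Ici 0)) (nhds 0) := by
    have hc : ContinuousAt (fun x : ℝ => C * (x ^ (p - (a + b : ℕ) / 4 : ℝ) * Real.exp (-x))) 0 :=
      continuousAt_const.mul ((Real.continuousAt_rpow_const _ _ (Or.inr hs.le)).mul (by fun_prop))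
    have := hc.tendsto
    simp only [Real.zero_rpow hs.ne', zero_mul, mul_zero] at this
    exact this.mono_left nhdsWithin_le_nhds
  have h0 : (0 : ℝ) ^ p = 0 := zero_pow (by omega)
  rw [ContinuousWithinAt, h0, zero_mul]
  refine squeeze_zero_norm' ?_ hg
  filter_upwards [self_mem_nhdsWithin] with x hx
  rcases eq_or_lt_of_le (Set.mem_Ici.mp hx) with rfl | hx
  · rw [h0, zero_mul, Real.zero_rpow hs.ne', zero_mul, mul_zero, norm_zero]
  · exact h x hx

/-- The moments `∫₀^∞ x^p K₀^a (x K₀')^b dx`. -/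
noncomputable def besselMixedMoment (a b p : ℕ) : ℝ :=
  ∫ x in Set.Ioi (0 : ℝ), x ^ p * (besselK0 x ^ a * besselK0Theta x ^ b)

lemma besselMixedMoment_recursion {a b p : ℕ} (h2 : 2 ≤ a + b) (h6 : a + b ≤ 5) (hp : 1 ≤ p) :
    (p + 1) * besselMixedMoment a b p + a * besselMixedMoment (a - 1) (b + 1) p
      + b * besselMixedMoment (a + 1) (b - 1) (p + 2) = 0 := by
  have i1 := (integrableOn_pow_mul_besselK0_pow_mul h2 (by omega) hp).const_mul ((p : ℝ) + 1)
  have i2 := (integrableOn_pow_mul_besselK0_pow_mul (a := a - 1) (b := b + 1) (p := p)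
    (by omega) (by omega) hp).const_mul (a : ℝ)
  have i3 := (integrableOn_pow_mul_besselK0_pow_mul (a := a + 1) (b := b - 1) (p := p + 2)
    (by omega) (by omega) (by omega)).const_mul (b : ℝ)
  have i12 : IntegrableOn (fun x => (p + 1) * (x ^ p * (besselK0 x ^ a * besselK0Theta x ^ b))
      + a * (x ^ p * (besselK0 x ^ (a - 1) * besselK0Theta x ^ (b + 1)))) (Set.Ioi 0) := i1.add i2
  have hint : IntegrableOn (fun x => (p + 1) * (x ^ p * (besselK0 x ^ a * besselK0Theta x ^ b))
      + a * (x ^ p * (besselK0 x ^ (a - 1) * besselK0Theta x ^ (b + 1)))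
      + b * (x ^ (p + 2) * (besselK0 x ^ (a + 1) * besselK0Theta x ^ (b - 1)))) (Set.Ioi 0) :=
    i12.add i3
  have hd : ∀ x ∈ Set.Ioi (0 : ℝ),
      HasDerivAt (fun x => x ^ (p + 1) * (besselK0 x ^ a * besselK0Theta x ^ b))
        ((p + 1) * (x ^ p * (besselK0 x ^ a * besselK0Theta x ^ b))
          + a * (x ^ p * (besselK0 x ^ (a - 1) * besselK0Theta x ^ (b + 1)))
          + b * (x ^ (p + 2) * (besselK0 x ^ (a + 1) * besselK0Theta x ^ (b - 1)))) x :=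
    fun x hx => by
      have hx0 : x ≠ 0 := ne_of_gt hx
      refine ((hasDerivAt_pow (p + 1) x).mul (((hasDerivAt_besselK0 hx).pow a).mul
        ((hasDerivAt_besselK0Theta hx).pow b))).congr_deriv ?_
      simp only [Pi.pow_apply, Pi.mul_apply, Nat.add_sub_cancel]
      push_cast
      field_simp
      ring
  have hlim := tendsto_zero_of_hasDerivAt_of_integrableOn_Ioi hd hint
    (integrableOn_pow_mul_besselK0_pow_mul h2 (by omega) (by omega))
  have key := integral_Ioi_of_hasDerivAt_of_tendsto
    (continuousWithinAt_pow_mul_besselK0_pow_mul h2 (by omega) (by omega)) hd hint hlim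
  rw [integral_add i12 i3, integral_add i1 i2, integral_const_mul, integral_const_mul,
    integral_const_mul] at key
  simpa [besselMixedMoment] using key

lemma besselMoment_eq_besselMixedMoment (m k : ℕ) :
    besselMoment m k = besselMixedMoment m 0 k := by
  simp [besselMoment, besselMixedMoment]

lemma besselMoment_five_recursion {p : ℕ} (hp : 1 ≤ p) :
    ((p : ℝ) + 1) ^ 6 * besselMoment 5 p
      - (35 * (p : ℝ) ^ 4 + 280 * (p : ℝ) ^ 3 + 882 * (p : ℝ) ^ 2 + 1288 * p + 731)
          * besselMoment 5 (p + 2)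
      + (259 * (p : ℝ) ^ 2 + 1554 * p + 2435) * besselMoment 5 (p + 4)
      - 225 * besselMoment 5 (p + 6) = 0 := by
  have h0 : ∀ q : ℕ, 1 ≤ q → besselMixedMoment 4 1 q
      = -((q + 1) / 5) * besselMixedMoment 5 0 q := fun q hq => by
    have := besselMixedMoment_recursion (a := 5) (b := 0) (by norm_num) le_rfl hq
    norm_num at this
    linarith
  have h1 : ∀ q : ℕ, 1 ≤ q → besselMixedMoment 3 2 q
      = -((q + 1) / 4) * besselMixedMoment 4 1 q - 1 / 4 * besselMixedMoment 5 0 (q + 2) :=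
    fun q hq => by
      have := besselMixedMoment_recursion (a := 4) (b := 1) (by norm_num) le_rfl hq
      norm_num at this
      linarith
  have h2 : ∀ q : ℕ, 1 ≤ q → besselMixedMoment 2 3 q
      = -((q + 1) / 3) * besselMixedMoment 3 2 q - 2 / 3 * besselMixedMoment 4 1 (q + 2) :=
    fun q hq => by
      have := besselMixedMoment_recursion (a := 3) (b := 2) (by norm_num) le_rfl hq
      norm_num at this
      linarith
  have h3 : ∀ q : ℕ, 1 ≤ q → besselMixedMoment 1 4 q
      = -((q + 1) / 2) * besselMixedMoment 2 3 q - 3 / 2 * besselMixedMoment 3 2 (q + 2) :=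
    fun q hq => by
      have := besselMixedMoment_recursion (a := 2) (b := 3) (by norm_num) le_rfl hq
      norm_num at this
      linarith
  have h4 : ∀ q : ℕ, 1 ≤ q → besselMixedMoment 0 5 q
      = -(q + 1) * besselMixedMoment 1 4 q - 4 * besselMixedMoment 2 3 (q + 2) :=
    fun q hq => by
      have := besselMixedMoment_recursion (a := 1) (b := 4) (by norm_num) le_rfl hq
      norm_num at this
      linarith
  have h5 := besselMixedMoment_recursion (a := 0) (b := 5) (by norm_num) le_rfl hp
  norm_num at h5
  simp (disch := omega) only [h4, h3, h2, h1, h0, add_assoc] at h5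
  norm_num at h5
  simp only [besselMoment_eq_besselMixedMoment]
  linear_combination -120 * h5

/-- With `d_n = (15^{2n}/(n!)²) c_{5,2n+1}`, for every `n ≥ 3`,
`n²(n−1)² d_n = 4(n−1)²(259n²−518n+285) d_{n−1}
  − 3600(35n⁴−210n³+483n²−504n+201) d_{n−2} + 3240000(n−2)⁴ d_{n−3}`. -/
theorem bessel_moment_five_d_recursion
    (d : ℕ → ℝ)
    (hd : ∀ n, d n = 15 ^ (2 * n) / (n.factorial : ℝ) ^ 2 * besselMoment 5 (2 * n + 1))
    (n : ℕ) (hn : 3 ≤ n) :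
    (n : ℝ) ^ 2 * ((n : ℝ) - 1) ^ 2 * d n
      = 4 * ((n : ℝ) - 1) ^ 2 * (259 * (n : ℝ) ^ 2 - 518 * n + 285) * d (n - 1)
        - 3600 * (35 * (n : ℝ) ^ 4 - 210 * (n : ℝ) ^ 3 + 483 * (n : ℝ) ^ 2 - 504 * n + 201)
            * d (n - 2)
        + 3240000 * ((n : ℝ) - 2) ^ 4 * d (n - 3) := by
  obtain ⟨k, rfl⟩ : ∃ k, n = k + 3 := ⟨n - 3, by omega⟩
  have h := besselMoment_five_recursion (p := 2 * k + 1) (by omega)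
  have e1 : k + 3 - 1 = k + 2 := by omega
  have e2 : k + 3 - 2 = k + 1 := by omega
  have e3 : k + 3 - 3 = k := by omega
  have f0 : 2 * (k + 3) + 1 = 2 * k + 1 + 6 := by ring
  have f1 : 2 * (k + 2) + 1 = 2 * k + 1 + 4 := by ring
  have f2 : 2 * (k + 1) + 1 = 2 * k + 1 + 2 := by ring
  have hf : (k.factorial : ℝ) ≠ 0 := by positivity
  have hk : (k : ℝ) + 1 ≠ 0 := by positivity
  have hk2 : (k : ℝ) + 2 ≠ 0 := by positivity
  have hk3 : (k : ℝ) + 3 ≠ 0 := by positivity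
  have g1 : ((k + 1).factorial : ℝ) = (k + 1) * k.factorial := by
    push_cast [Nat.factorial_succ]; ring
  have g2 : ((k + 2).factorial : ℝ) = (k + 2) * ((k + 1) * k.factorial) := by
    push_cast [Nat.factorial_succ]; ring
  have g3 : ((k + 3).factorial : ℝ) = (k + 3) * ((k + 2) * ((k + 1) * k.factorial)) := by
    push_cast [Nat.factorial_succ]; ring
  rw [e1, e2, e3, hd, hd, hd, hd, f0, f1, f2, g1, g2, g3]
  push_cast at h ⊢
  have s1 : (k : ℝ) + 3 - 1 = k + 2 := by ring
  have s2 : (k : ℝ) + 3 - 2 = k + 1 := by ring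
  rw [s1, s2, mul_add 2 k 3, mul_add 2 k 2, mul_add 2 k 1, pow_add, pow_add, pow_add]
  field_simp
  linear_combination (-50625) * h
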